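/- For every odd integer n ≥ 3 and all a, y > 0, the grafted-polygon partition function satisfies P^G_{2n}(a,y) = (1/a) Σ_{k=0}^{(n−3)/2} s_{(n−3)/2}(k,0) ŝ_{(n−1)/2}(k,0) y^{k+2} + Σ_{k=0}^{(n−3)/2} Σ_{m=1}^{k} s_{(n−3)/2}(k,m) ŝ_{(n−1)/2}(k,m) y^{k+2}. -/

import Mathlib

open Finset Filter

attribute [local instance] Classical.propDecidable

/-- Height (second coordinate) of a binomial path after `i` steps, starting at height `c`;
steps are encoded by `s : Fin n → Bool` (`true` = up step `(1,1)`, `false` = down step `(1,-1)`).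
The path visits the points `(x₀ + i, hgt c s i)` for `0 ≤ i ≤ n`. -/
def hgt {n : ℕ} (c : ℤ) (s : Fin n → Bool) (i : ℕ) : ℤ :=
  c + ∑ j ∈ Finset.range i, (if h : j < n then (if s ⟨j, h⟩ then (1 : ℤ) else -1) else 0)

/-- The path lies in the upper half-plane (all second coordinates ≥ 0). -/
def InUHP {n : ℕ} (c : ℤ) (s : Fin n → Bool) : Prop :=
  ∀ i ≤ n, 0 ≤ hgt c s i

/-- The number of vertices of the path with second coordinate 0. -/
def visits {n : ℕ} (c : ℤ) (s : Fin n → Bool) : ℕ :=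
  ((Finset.range (n + 1)).filter (fun i => hgt c s i = 0)).card

/-- `(c, sp, sm)` encodes a staircase polygon of length `2n` in `𝒫^S_{2n}`:
both binomial paths of length `n` start at `(0, c)` (so the leftmost vertex has first
coordinate `0`), they end at the same point, the upper path `sp` is strictly above the
lower path `sm` at the intermediate points, the polygon lies in the upper half-plane,
and it has at least one vertex with second coordinate `0`. -/
def IsStaircase {n : ℕ} (c : ℤ) (sp sm : Fin n → Bool) : Prop :=
  hgt c sp n = hgt c sm n ∧
  (∀ i, 0 < i → i < n → hgt c sm i < hgt c sp i) ∧
  InUHP c sp ∧ InUHP c sm ∧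
  (∃ i ≤ n, hgt c sp i = 0 ∨ hgt c sm i = 0)

/-- `P^G_{2n}(a,y)`: partition function of grafted staircase polygons of length `2n`,
i.e. those whose leftmost vertex has second coordinate `1` and whose rightmost vertex
has second coordinate `1` if `n` is even and `2` if `n` is odd. -/
noncomputable def PG (n : ℕ) (a y : ℝ) : ℝ :=
  ∑ p ∈ (Finset.univ : Finset (Fin (n + 1) × (Fin n → Bool) × (Fin n → Bool))).filter
      (fun p => IsStaircase ((p.1 : ℕ) : ℤ) p.2.1 p.2.2 ∧ ((p.1 : ℕ) : ℤ) = 1 ∧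
        hgt ((p.1 : ℕ) : ℤ) p.2.1 n = (if n % 2 = 0 then 1 else 2)),
    a ^ visits ((p.1 : ℕ) : ℤ) p.2.2 * y ^ hgt ((p.1 : ℕ) : ℤ) p.2.1 (n / 2)

/-- `s¹_n(k,m)`: the number of pairs `(σ, τ)` of binomial paths of length `n` in the
upper half-plane, with `σ` from `(0,0)` to `(n,m)`, `τ` from `(0,2)` to `(n,k+2)`, and
the second coordinate of `τᵢ` strictly greater than that of `σᵢ` for all `0 ≤ i ≤ n`. -/
noncomputable def s1Count (n k m : ℕ) : ℕ :=
  ((Finset.univ : Finset ((Fin n → Bool) × (Fin n → Bool))).filter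
    (fun p => InUHP 0 p.1 ∧ InUHP 2 p.2 ∧ (∀ i ≤ n, hgt 0 p.1 i < hgt 2 p.2 i) ∧
      hgt 0 p.1 n = (m : ℤ) ∧ hgt 2 p.2 n = (k : ℤ) + 2)).card

/-- `s_n(k,m)`: the sum, over the same pairs `(σ, τ)` as in `s1Count`, of `a` raised to
the number of vertices of the lower path `σ` with second coordinate `0`. -/
noncomputable def sW (a : ℝ) (n k m : ℕ) : ℝ :=
  ∑ p ∈ (Finset.univ : Finset ((Fin n → Bool) × (Fin n → Bool))).filter
      (fun p => InUHP 0 p.1 ∧ InUHP 2 p.2 ∧ (∀ i ≤ n, hgt 0 p.1 i < hgt 2 p.2 i) ∧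
        hgt 0 p.1 n = (m : ℤ) ∧ hgt 2 p.2 n = (k : ℤ) + 2),
    a ^ visits 0 p.1

/-- `ŝ¹_n(k,m)`: the number of pairs `(σ, τ)` of binomial paths of length `n` in the
upper half-plane, with `σ` from `(0,1)` to `(n,m)`, `τ` from `(0,3)` to `(n,k+2)`, and
the second coordinate of `τᵢ` strictly greater than that of `σᵢ` for all `0 ≤ i ≤ n`. -/
noncomputable def s1hatCount (n k m : ℕ) : ℕ :=
  ((Finset.univ : Finset ((Fin n → Bool) × (Fin n → Bool))).filter
    (fun p => InUHP 1 p.1 ∧ InUHP 3 p.2 ∧ (∀ i ≤ n, hgt 1 p.1 i < hgt 3 p.2 i) ∧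
      hgt 1 p.1 n = (m : ℤ) ∧ hgt 3 p.2 n = (k : ℤ) + 2)).card

/-- `ŝ_n(k,m)`: the sum, over the same pairs `(σ, τ)` as in `s1hatCount` (lower path from
`(0,1)` to `(n,m)`, upper path from `(0,3)` to `(n,k+2)`), of `a` raised to the number of
vertices of the lower path with second coordinate `0`. -/
noncomputable def sWhat (a : ℝ) (n k m : ℕ) : ℝ :=
  ∑ p ∈ (Finset.univ : Finset ((Fin n → Bool) × (Fin n → Bool))).filter
      (fun p => InUHP 1 p.1 ∧ InUHP 3 p.2 ∧ (∀ i ≤ n, hgt 1 p.1 i < hgt 3 p.2 i) ∧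
        hgt 1 p.1 n = (m : ℤ) ∧ hgt 3 p.2 n = (k : ℤ) + 2),
    a ^ visits 1 p.1

theorem hgt_zero {n : ℕ} (c : ℤ) (s : Fin n → Bool) : hgt c s 0 = c := by
  simp [hgt]

theorem hgt_succ {n : ℕ} (c : ℤ) (s : Fin n → Bool) (i : ℕ) (h : i < n) :
    hgt c s (i + 1) = hgt c s i + (if s ⟨i, h⟩ then (1 : ℤ) else -1) := by
  simp [hgt, Finset.sum_range_succ, h, add_assoc]

theorem hgt_shift {n : ℕ} (c d : ℤ) (s : Fin n → Bool) (i : ℕ) :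
    hgt c s i = hgt d s i + (c - d) := by
  simp only [hgt]; ring

theorem hgt_last {N : ℕ} (c : ℤ) (s : Fin (2 * N + 3) → Bool) :
    hgt c s (2 * N + 3) =
      hgt c s (2 * N + 2) + (if s ⟨2 * N + 2, by omega⟩ then (1 : ℤ) else -1) :=
  hgt_succ c s (2 * N + 2) (by omega)

/-- Steps 1..N of a path of length 2N+3. -/
def headP {N : ℕ} (s : Fin (2 * N + 3) → Bool) : Fin N → Bool :=
  fun j => s ⟨j.1 + 1, by omega⟩

/-- Reversal of steps N+1..2N+1 of a path of length 2N+3. -/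
def tailP {N : ℕ} (s : Fin (2 * N + 3) → Bool) : Fin (N + 1) → Bool :=
  fun j => ! s ⟨2 * N + 1 - j.1, by omega⟩

/-- Inverse operation. -/
def glueP {N : ℕ} (b : Bool) (σ : Fin N → Bool) (ρ : Fin (N + 1) → Bool) :
    Fin (2 * N + 3) → Bool :=
  fun i => if h0 : i.1 = 0 then b
    else if h1 : i.1 ≤ N then σ ⟨i.1 - 1, by omega⟩
    else if h2 : i.1 ≤ 2 * N + 1 then ! ρ ⟨2 * N + 1 - i.1, by omega⟩
    else ! b

theorem headP_glueP {N : ℕ} (b : Bool) (σ : Fin N → Bool) (ρ : Fin (N + 1) → Bool) :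
    headP (glueP b σ ρ) = σ := by
  funext j
  have := j.2
  have h1 : j.1 + 1 ≤ N := by omega
  simp [headP, glueP, h1]

theorem tailP_glueP {N : ℕ} (b : Bool) (σ : Fin N → Bool) (ρ : Fin (N + 1) → Bool) :
    tailP (glueP b σ ρ) = ρ := by
  funext j
  have := j.2
  have h0 : ¬ (2 * N + 1 - j.1 = 0) := by omega
  have h1 : ¬ (2 * N + 1 - j.1 ≤ N) := by omega
  have h2 : 2 * N + 1 - j.1 ≤ 2 * N + 1 := by omega
  have h3 : 2 * N + 1 - (2 * N + 1 - j.1) = j.1 := by omega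
  simp only [tailP, glueP, h0, h1, h2, h3, dite_true, dite_false, Bool.not_not]

theorem glueP_first {N : ℕ} (b : Bool) (σ : Fin N → Bool) (ρ : Fin (N + 1) → Bool) :
    glueP b σ ρ ⟨0, by omega⟩ = b := by
  simp [glueP]

theorem glueP_last {N : ℕ} (b : Bool) (σ : Fin N → Bool) (ρ : Fin (N + 1) → Bool) :
    glueP b σ ρ ⟨2 * N + 2, by omega⟩ = ! b := by
  have h1 : ¬ (2 * N + 2 ≤ N) := by omega
  simp [glueP, h1]

theorem glueP_eta {N : ℕ} (b : Bool) (s : Fin (2 * N + 3) → Bool)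
    (h0 : s ⟨0, by omega⟩ = b) (hl : s ⟨2 * N + 2, by omega⟩ = ! b) :
    glueP b (headP s) (tailP s) = s := by
  funext ⟨i, hi⟩
  simp only [glueP, headP, tailP]
  split_ifs with h1 h2 h3
  · subst h1; exact h0.symm
  · congr 2; omega
  · rw [Bool.not_not]; congr 2; omega
  · have : i = 2 * N + 2 := by omega
    subst this; exact hl.symm

theorem hgt_head {N : ℕ} (c : ℤ) (s : Fin (2 * N + 3) → Bool) (i : ℕ) (hi : i ≤ N) :
    hgt (hgt c s 1) (headP s) i = hgt c s (i + 1) := by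
  induction i with
  | zero => simp [hgt_zero]
  | succ i ih =>
    rw [hgt_succ _ _ _ (by omega), ih (by omega), hgt_succ c s (i + 1) (by omega)]
    rfl

theorem hgt_tail {N : ℕ} (c : ℤ) (s : Fin (2 * N + 3) → Bool) (i : ℕ) (hi : i ≤ N + 1) :
    hgt (hgt c s (2 * N + 2)) (tailP s) i = hgt c s (2 * N + 2 - i) := by
  induction i with
  | zero => simp [hgt_zero]
  | succ i ih =>
    rw [hgt_succ _ _ _ (by omega), ih (by omega)]
    have e : 2 * N + 2 - i = (2 * N + 2 - (i + 1)) + 1 := by omega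
    rw [e, hgt_succ c s _ (by omega)]
    have e2 : (⟨2 * N + 2 - (i + 1), by omega⟩ : Fin (2 * N + 3)) = ⟨2 * N + 1 - i, by omega⟩ := by
      ext; simp
    rw [e2]
    simp only [tailP]
    by_cases hb : s ⟨2 * N + 1 - i, by omega⟩ = true <;> simp [hb]

theorem hgt_parity {n : ℕ} (c : ℤ) (s t : Fin n → Bool) (i : ℕ) (h : i ≤ n) :
    (2 : ℤ) ∣ hgt c s i - hgt c t i := by
  induction i with
  | zero => simp [hgt_zero]
  | succ i ih =>
    have := ih (by omega)
    rw [hgt_succ _ _ _ (by omega), hgt_succ _ _ _ (by omega)]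
    split_ifs <;> omega

theorem hgt_le {n : ℕ} (c : ℤ) (s : Fin n → Bool) (i : ℕ) (h : i ≤ n) :
    hgt c s i ≤ c + i := by
  induction i with
  | zero => simp [hgt_zero]
  | succ i ih =>
    have := ih (by omega)
    rw [hgt_succ _ _ _ (by omega)]
    push_cast
    split_ifs <;> omega

/-- Endpoint data. -/
theorem core_iff {N k m : ℕ} (sp sm : Fin (2 * N + 3) → Bool) :
    (IsStaircase 1 sp sm ∧ hgt 1 sp (2 * N + 3) = 2 ∧ hgt 1 sp (N + 1) = (k : ℤ) + 2 ∧
      hgt 1 sm (N + 1) = (m : ℤ)) ↔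
    ((sp ⟨0, by omega⟩ = true ∧ sp ⟨2 * N + 2, by omega⟩ = !true) ∧
     (sm ⟨0, by omega⟩ = false ∧ sm ⟨2 * N + 2, by omega⟩ = !false) ∧
     (InUHP 0 (headP sm) ∧ InUHP 2 (headP sp) ∧
      (∀ i ≤ N, hgt 0 (headP sm) i < hgt 2 (headP sp) i) ∧
      hgt 0 (headP sm) N = (m : ℤ) ∧ hgt 2 (headP sp) N = (k : ℤ) + 2) ∧
     (InUHP 1 (tailP sm) ∧ InUHP 3 (tailP sp) ∧
      (∀ i ≤ N + 1, hgt 1 (tailP sm) i < hgt 3 (tailP sp) i) ∧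
      hgt 1 (tailP sm) (N + 1) = (m : ℤ) ∧ hgt 3 (tailP sp) (N + 1) = (k : ℤ) + 2)) := by
  have p1 := hgt_succ 1 sp 0 (by omega)
  have m1 := hgt_succ 1 sm 0 (by omega)
  have pl := hgt_last 1 sp
  have ml := hgt_last 1 sm
  have hp := hgt_head 1 sp
  have hm := hgt_head 1 sm
  have tp := hgt_tail 1 sp
  have tm := hgt_tail 1 sm
  rw [hgt_zero] at p1 m1
  simp only [zero_add] at p1 m1
  constructor
  · rintro ⟨⟨h1, h2, h3, h4, -⟩, h5, h6, h7⟩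
    have a1 := h2 1 (by omega) (by omega)
    have a2 := h2 (2 * N + 2) (by omega) (by omega)
    have e1 : sp ⟨0, by omega⟩ = true := by
      by_contra hh; split_ifs at p1 m1 <;> simp_all
    have e2 : sm ⟨0, by omega⟩ = false := by
      by_contra hh; split_ifs at p1 m1 <;> simp_all
    have e3 : sp ⟨2 * N + 2, by omega⟩ = false := by
      by_contra hh; rw [if_pos (by simpa using hh)] at pl; split_ifs at ml <;> omega
    have e4 : sm ⟨2 * N + 2, by omega⟩ = true := by
      by_contra hh; rw [if_neg (by simpa using hh)] at ml; split_ifs at pl <;> omega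
    rw [e1] at p1; rw [e2] at m1; rw [e3] at pl; rw [e4] at ml
    have q1 : hgt 1 sp 1 = 2 := by simpa using p1
    have q2 : hgt 1 sm 1 = 0 := by simpa using m1
    have q3 : hgt 1 sp (2 * N + 2) = 3 := by simp at pl; omega
    have q4 : hgt 1 sm (2 * N + 2) = 1 := by simp at ml; omega
    rw [q1] at hp; rw [q2] at hm; rw [q3] at tp; rw [q4] at tm
    refine ⟨⟨e1, e3⟩, ⟨e2, e4⟩, ⟨?_, ?_, ?_, ?_, ?_⟩, ?_, ?_, ?_, ?_, ?_⟩
    · intro i hi; rw [hm i hi]; exact h4 _ (by omega)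
    · intro i hi; rw [hp i hi]; exact h3 _ (by omega)
    · intro i hi; rw [hm i hi, hp i hi]; exact h2 _ (by omega) (by omega)
    · rw [hm N le_rfl, h7]
    · rw [hp N le_rfl, h6]
    · intro i hi; rw [tm i hi]; exact h4 _ (by omega)
    · intro i hi; rw [tp i hi]; exact h3 _ (by omega)
    · intro i hi; rw [tm i hi, tp i hi]; exact h2 _ (by omega) (by omega)
    · rw [tm _ le_rfl, ← h7]; congr 1; omega
    · rw [tp _ le_rfl, ← h6]; congr 1; omega
  · rintro ⟨⟨e1, e3⟩, ⟨e2, e4⟩, ⟨b1, b2, b3, b4, b5⟩, c1, c2, c3, c4, c5⟩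
    rw [e1] at p1; rw [e2] at m1; rw [e3] at pl; rw [e4] at ml
    have q1 : hgt 1 sp 1 = 2 := by simpa using p1
    have q2 : hgt 1 sm 1 = 0 := by simpa using m1
    rw [q1] at hp; rw [q2] at hm
    have r1 : hgt 1 sp (N + 1) = (k : ℤ) + 2 := by rw [← hp N le_rfl, b5]
    have r2 : hgt 1 sm (N + 1) = (m : ℤ) := by rw [← hm N le_rfl, b4]
    have q3 : hgt 1 sp (2 * N + 2) = 3 := by
      have := tp (N + 1) le_rfl
      rw [show 2 * N + 2 - (N + 1) = N + 1 by omega, hgt_shift _ 3] at this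
      omega
    have q4 : hgt 1 sm (2 * N + 2) = 1 := by
      have := tm (N + 1) le_rfl
      rw [show 2 * N + 2 - (N + 1) = N + 1 by omega, hgt_shift _ 1] at this
      omega
    have q5 : hgt 1 sp (2 * N + 3) = 2 := by
      rw [pl, q3]; simp
    have q6 : hgt 1 sm (2 * N + 3) = 2 := by
      rw [ml, q4]; simp
    rw [q3] at tp; rw [q4] at tm
    have key : ∀ i, 0 < i → i < 2 * N + 3 →
        hgt 1 sm i < hgt 1 sp i ∧ 0 ≤ hgt 1 sp i ∧ 0 ≤ hgt 1 sm i := by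
      intro i h0 hi
      by_cases hN : i ≤ N + 1
      · obtain ⟨j, rfl⟩ : ∃ j, i = j + 1 := ⟨i - 1, by omega⟩
        rw [← hm j (by omega), ← hp j (by omega)]
        exact ⟨b3 j (by omega), b2 j (by omega), b1 j (by omega)⟩
      · obtain ⟨j, hj, rfl⟩ : ∃ j, j ≤ N + 1 ∧ i = 2 * N + 2 - j :=
          ⟨2 * N + 2 - i, by omega, by omega⟩
        rw [← tm j hj, ← tp j hj]
        exact ⟨c3 j hj, c2 j hj, c1 j hj⟩
    refine ⟨⟨by rw [q5, q6], fun i h0 hi => (key i h0 hi).1, ?_, ?_, 1, by omega, Or.inr q2⟩,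
      q5, r1, r2⟩
    · intro i hi
      rcases Nat.eq_zero_or_pos i with rfl | h0
      · rw [hgt_zero]; norm_num
      · rcases Nat.lt_or_ge i (2 * N + 3) with h | h
        · exact (key i h0 h).2.1
        · rw [show i = 2 * N + 3 by omega, q5]; norm_num
    · intro i hi
      rcases Nat.eq_zero_or_pos i with rfl | h0
      · rw [hgt_zero]; norm_num
      · rcases Nat.lt_or_ge i (2 * N + 3) with h | h
        · exact (key i h0 h).2.2
        · rw [show i = 2 * N + 3 by omega, q6]; norm_num

theorem visits_eq_sum {n : ℕ} (c : ℤ) (s : Fin n → Bool) :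
    visits c s = ∑ i ∈ Finset.range (n + 1), (if hgt c s i = 0 then 1 else 0) := by
  rw [visits, Finset.card_filter]

theorem visits_split {N : ℕ} (s : Fin (2 * N + 3) → Bool)
    (h0 : hgt 1 s 1 = 0) (h1 : hgt 1 s (2 * N + 2) = 1) (h2 : hgt 1 s (2 * N + 3) = 2) :
    visits 1 s + (if hgt 1 s (N + 1) = 0 then 1 else 0) =
      visits 0 (headP s) + visits 1 (tailP s) := by
  rw [visits_eq_sum, visits_eq_sum, visits_eq_sum]
  have hh := hgt_head 1 s
  have ht := hgt_tail 1 s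
  rw [h0] at hh; rw [h1] at ht
  set f : ℕ → ℕ := fun i => if hgt 1 s i = 0 then 1 else 0 with hf
  have A : ∑ i ∈ Finset.range (N + 1), (if hgt 0 (headP s) i = 0 then 1 else 0)
      = ∑ i ∈ Finset.range (N + 1), f (i + 1) := by
    refine Finset.sum_congr rfl fun i hi => ?_
    rw [Finset.mem_range] at hi
    rw [hh i (by omega)]
  have B : ∑ i ∈ Finset.range (N + 1 + 1), (if hgt 1 (tailP s) i = 0 then 1 else 0)
      = ∑ i ∈ Finset.range (N + 1 + 1), f (N + 1 + i) := by
    rw [← Finset.sum_range_reflect (fun i => f (N + 1 + i))]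
    refine Finset.sum_congr rfl fun i hi => ?_
    rw [Finset.mem_range] at hi
    rw [ht i (by omega)]
    simp only [hf]
    rw [show N + 1 + (N + 1 + 1 - 1 - i) = 2 * N + 2 - i by omega]
  rw [A, B]
  have f0 : f 0 = 0 := by simp [hf, hgt_zero]
  have fl : f (2 * N + 3) = 0 := by simp [hf, h2]
  have C : ∑ i ∈ Finset.range (2 * N + 3 + 1), f i
      = ∑ i ∈ Finset.range (N + 1), f (i + 1) + ∑ i ∈ Finset.range (N + 1), f (N + 1 + (i + 1)) := by
    rw [Finset.sum_range_succ, fl, Finset.sum_range_succ', f0,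
      show 2 * N + 2 = (N + 1) + (N + 1) by omega, Finset.sum_range_add]
    simp only [add_zero, add_assoc]
  change ∑ i ∈ Finset.range (2 * N + 3 + 1), f i + f (N + 1) = _
  rw [C, Finset.sum_range_succ' (fun i => f (N + 1 + i)) (N + 1)]
  simp only [add_zero, add_assoc]

/-- Weight correction. -/
noncomputable def wt (a : ℝ) (m : ℕ) : ℝ := if m = 0 then 1 / a else 1

theorem fiber_eq (N k m : ℕ) (a y : ℝ) (ha : 0 < a) :
    ∑ p ∈ (Finset.univ : Finset ((Fin (2 * N + 3) → Bool) × (Fin (2 * N + 3) → Bool))).filter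
      (fun p => IsStaircase 1 p.1 p.2 ∧ hgt 1 p.1 (2 * N + 3) = 2 ∧
        hgt 1 p.1 (N + 1) = (k : ℤ) + 2 ∧ hgt 1 p.2 (N + 1) = (m : ℤ)),
      a ^ visits 1 p.2 * y ^ hgt 1 p.1 (N + 1)
    = wt a m * (sW a N k m * sWhat a (N + 1) k m * y ^ (k + 2)) := by
  rw [sW, sWhat, Finset.sum_mul_sum, ← Finset.sum_product', Finset.sum_mul, Finset.mul_sum]
  refine Finset.sum_bij' (fun p _ => ((headP p.2, headP p.1), (tailP p.2, tailP p.1)))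
    (fun q _ => (glueP true q.1.2 q.2.2, glueP false q.1.1 q.2.1)) ?_ ?_ ?_ ?_ ?_
  · intro p hp
    simp only [Finset.mem_filter, Finset.mem_univ, true_and, Finset.mem_product] at hp ⊢
    exact ((core_iff p.1 p.2).1 hp).2.2
  · intro q hq
    simp only [Finset.mem_filter, Finset.mem_univ, true_and, Finset.mem_product] at hq ⊢
    rw [core_iff]
    simp only [headP_glueP, tailP_glueP]
    exact ⟨⟨glueP_first _ _ _, glueP_last _ _ _⟩, ⟨glueP_first _ _ _, glueP_last _ _ _⟩, hq⟩
  · intro p hp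
    simp only [Finset.mem_filter, Finset.mem_univ, true_and] at hp
    obtain ⟨⟨h1, h2⟩, ⟨h3, h4⟩, -⟩ := (core_iff p.1 p.2).1 hp
    exact Prod.ext (glueP_eta _ _ h1 h2) (glueP_eta _ _ h3 h4)
  · intro q hq
    simp only [headP_glueP, tailP_glueP]
  · intro p hp
    simp only [Finset.mem_filter, Finset.mem_univ, true_and] at hp
    obtain ⟨-, ⟨h3, h4⟩, -⟩ := (core_iff p.1 p.2).1 hp
    obtain ⟨hs, h5, h6, h7⟩ := hp
    have g1 : hgt 1 p.2 1 = 0 := by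
      have := hgt_succ 1 p.2 0 (by omega)
      rw [h3, hgt_zero] at this; simpa using this
    have g3 : hgt 1 p.2 (2 * N + 3) = 2 := by rw [← hs.1, h5]
    have g2 : hgt 1 p.2 (2 * N + 2) = 1 := by
      have := hgt_last 1 p.2
      rw [h4, g3] at this
      simp at this; omega
    have hv := visits_split p.2 g1 g2 g3
    rw [h7] at hv
    rw [h6, ← pow_add, ← hv, wt]
    have hy2 : y ^ ((k : ℤ) + 2) = y ^ (k + 2) := by
      rw [← zpow_natCast]; norm_cast
    rw [hy2]
    by_cases hm : m = 0
    · subst hm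
      simp only [Nat.cast_zero, if_true, pow_succ]
      field_simp
    · have : ¬ ((m : ℤ) = 0) := by exact_mod_cast hm
      simp [hm]

theorem PG_eq (N : ℕ) (a y : ℝ) :
    PG (2 * N + 3) a y =
    ∑ p ∈ (Finset.univ : Finset ((Fin (2 * N + 3) → Bool) × (Fin (2 * N + 3) → Bool))).filter
      (fun p => IsStaircase 1 p.1 p.2 ∧ hgt 1 p.1 (2 * N + 3) = 2),
      a ^ visits 1 p.2 * y ^ hgt 1 p.1 (N + 1) := by
  have e : (2 * N + 3) / 2 = N + 1 := by omega
  have e' : ¬ ((2 * N + 3) % 2 = 0) := by omega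
  rw [PG, e]
  simp only [e', if_false]
  refine Finset.sum_bij' (fun p _ => p.2) (fun q _ => (⟨1, by omega⟩, q)) ?_ ?_ ?_ ?_ ?_
  · intro p hp
    simp only [Finset.mem_filter, Finset.mem_univ, true_and] at hp ⊢
    obtain ⟨h1, h2, h3⟩ := hp
    rw [h2] at h1 h3
    exact ⟨h1, h3⟩
  · intro q hq
    simp only [Finset.mem_filter, Finset.mem_univ, true_and] at hq ⊢
    exact ⟨by simpa using hq.1, by simp, by simpa using hq.2⟩
  · intro p hp
    simp only [Finset.mem_filter, Finset.mem_univ, true_and] at hp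
    refine Prod.ext (Fin.ext ?_) rfl
    have := hp.2.1
    simp only
    omega
  · intro q hq
    rfl
  · intro p hp
    simp only [Finset.mem_filter, Finset.mem_univ, true_and] at hp
    rw [hp.2.1]

theorem PG_sum (N : ℕ) (a y : ℝ) (ha : 0 < a) :
    PG (2 * N + 3) a y = ∑ k ∈ Finset.range (N + 1), ∑ m ∈ Finset.range (k + 1),
      wt a m * (sW a N k m * sWhat a (N + 1) k m * y ^ (k + 2)) := by
  rw [PG_eq, Finset.sum_sigma',
    ← Finset.sum_fiberwise_of_maps_to (t := (Finset.range (N + 1)).sigma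
        fun k => Finset.range (k + 1))
      (g := fun p => (⟨(hgt 1 p.1 (N + 1) - 2).toNat, (hgt 1 p.2 (N + 1)).toNat⟩ : Σ _ : ℕ, ℕ))]
  · refine Finset.sum_congr rfl fun x hx => ?_
    rw [← fiber_eq N x.1 x.2 a y ha, Finset.filter_filter]
    refine Finset.sum_congr (Finset.filter_congr fun p _ => ?_) fun _ _ => rfl
    rcases x with ⟨k, m⟩
    simp only [Sigma.mk.injEq, heq_eq_eq, and_assoc]
    refine and_congr_right fun hs => and_congr_right fun h5 => ?_
    have b1 := hs.2.1 (N + 1) (by omega) (by omega)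
    have b2 := hs.2.2.2.1 (N + 1) (by omega)
    have b3 := hgt_parity 1 p.1 p.2 (N + 1) (by omega)
    omega
  · intro p hp
    simp only [Finset.mem_filter, Finset.mem_univ, true_and] at hp
    obtain ⟨hs, -⟩ := hp
    have b1 := hs.2.1 (N + 1) (by omega) (by omega)
    have b2 := hs.2.2.2.1 (N + 1) (by omega)
    have b3 := hgt_parity 1 p.1 p.2 (N + 1) (by omega)
    have b4 := hgt_le 1 p.1 (N + 1) (by omega)
    simp only [Finset.mem_sigma, Finset.mem_range]
    push_cast at b4
    omega

/-- For odd `n`, the grafted-polygon partition function via pairs of paths. -/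
theorem PG_odd_eq (n : ℕ) (hn : 3 ≤ n) (hpar : n % 2 = 1) (a y : ℝ)
    (ha : 0 < a) (hy : 0 < y) :
    PG n a y =
      (1 / a) * ∑ k ∈ Finset.range ((n - 3) / 2 + 1),
          sW a ((n - 3) / 2) k 0 * sWhat a ((n - 1) / 2) k 0 * y ^ (k + 2)
        + ∑ k ∈ Finset.range ((n - 3) / 2 + 1), ∑ m ∈ Finset.Icc 1 k,
            sW a ((n - 3) / 2) k m * sWhat a ((n - 1) / 2) k m * y ^ (k + 2) := by
  obtain ⟨N, rfl⟩ : ∃ N, n = 2 * N + 3 := ⟨(n - 3) / 2, by omega⟩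
  have e1 : (2 * N + 3 - 3) / 2 = N := by omega
  have e2 : (2 * N + 3 - 1) / 2 = N + 1 := by omega
  rw [e1, e2, PG_sum N a y ha, Finset.mul_sum, ← Finset.sum_add_distrib]
  refine Finset.sum_congr rfl fun k _ => ?_
  rw [Finset.range_eq_Ico, Finset.sum_eq_sum_Ico_succ_bot (by omega)]
  congr 1
  refine Finset.sum_congr (by ext; simp) fun m hm => ?_
  have : m ≠ 0 := by
    simp at hm; omega
  simp [wt, this]
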